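/- There is a constant C > 0, depending only on |𝒴|, with the following property. Let 𝒳, 𝒴 be finite sets with |𝒳| ≥ 2 and |𝒴| ≥ 2, let n ≥ 27, let M be a finitely supported random variable, 𝐗 a random variable on 𝒳^n, W ∈ 𝒫(𝒴|𝒳), and 𝐘 an output of 𝐗 through W^n with M ⊸ 𝐗 ⊸ 𝐘, and let α ∈ (log₂(n)/n, 1/(8 ln 2)) and ζ ∈ ℕ₊. Then there exist: a random variable V that is a deterministic function of (𝐗, M) taking at most 2ζn·log₂|𝒴| values, a value v₀ of V with P(V=v₀) < (n/8)^{−(ζ−1)/n}, a real δ ∈ (0, C·√α·(−log₂ α)], and a function r from the values of V to [0,∞), such that for every finitely supported random variable U, jointly distributed with (M,𝐗,𝐘), from which V is almost surely recoverable as a deterministic function and which satisfies (U,M) ⊸ 𝐗 ⊸ 𝐘, and every value u of U with P(U=u) > 0 and P(V=v₀|U=u) = 0: Pr( |h(𝐘|U,M) − r(V)| > nδ + h_U(u) | U=u ) < 4·2^{−nα}. -/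

import Mathlib

open scoped Classical BigOperators

noncomputable section

namespace Paper

variable {Ω : Type*}

/-- Probability of an event under a discrete probability distribution. -/
def pr (μ : PMF Ω) (E : Set Ω) : ℝ := (μ.toOuterMeasure E).toReal

/-- Conditional probability `Pr(E | F)`. -/
def cpr (μ : PMF Ω) (E F : Set Ω) : ℝ := pr μ (E ∩ F) / pr μ F

/-- Entropy spectrum frequency `h_X(x) = -log₂ Pr(X = x)`. -/
def hs {α : Type*} (μ : PMF Ω) (X : Ω → α) (x : α) : ℝ :=
  - Real.logb 2 (pr μ {ω | X ω = x})

/-- Conditional entropy spectrum frequency `h_{X|Y}(x|y) = -log₂ Pr(X = x | Y = y)`. -/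
def hcs {α β : Type*} (μ : PMF Ω) (X : Ω → α) (Y : Ω → β) (x : α) (y : β) : ℝ :=
  - Real.logb 2 (cpr μ {ω | X ω = x} {ω | Y ω = y})

/-- Conditional Shannon entropy (bits) `H(X|Y)`. -/
def Hc {α β : Type*} [Fintype α] [Fintype β] (μ : PMF Ω) (X : Ω → α) (Y : Ω → β) : ℝ :=
  - ∑ x : α, ∑ y : β, pr μ ({ω | X ω = x} ∩ {ω | Y ω = y}) *
      Real.logb 2 (cpr μ {ω | X ω = x} {ω | Y ω = y})

/-- Shannon entropy (bits) of `X` conditioned on the event `E`. -/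
def HEvt {α : Type*} [Fintype α] (μ : PMF Ω) (X : Ω → α) (E : Set Ω) : ℝ :=
  - ∑ x : α, cpr μ {ω | X ω = x} E * Real.logb 2 (cpr μ {ω | X ω = x} E)

/-- Conditional Shannon entropy (bits) `H(X|Y)` computed given the event `E`. -/
def HcEvt {α β : Type*} [Fintype α] [Fintype β] (μ : PMF Ω) (X : Ω → α) (Y : Ω → β)
    (E : Set Ω) : ℝ :=
  - ∑ x : α, ∑ y : β, cpr μ ({ω | X ω = x} ∩ {ω | Y ω = y}) E *
      Real.logb 2 (cpr μ {ω | X ω = x} ({ω | Y ω = y} ∩ E))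

/-- `A ⊸ B ⊸ C` : `A` and `C` are conditionally independent given `B`. -/
def Markov {α β γ : Type*} (μ : PMF Ω) (A : Ω → α) (B : Ω → β) (C : Ω → γ) : Prop :=
  ∀ a b c, pr μ {ω | A ω = a ∧ B ω = b ∧ C ω = c} * pr μ {ω | B ω = b} =
    pr μ {ω | A ω = a ∧ B ω = b} * pr μ {ω | B ω = b ∧ C ω = c}

/-- A discrete memoryless channel from `𝒳` to `𝒴`. -/
structure Channel (𝒳 𝒴 : Type*) [Fintype 𝒴] where
  w : 𝒳 → 𝒴 → ℝ
  nonneg : ∀ x y, 0 ≤ w x y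
  sum_one : ∀ x, ∑ y, w x y = 1

/-- The `n`-fold product channel `W^n(𝐲|𝐱)`. -/
def Channel.pn {𝒳 𝒴 : Type*} [Fintype 𝒴] (W : Channel 𝒳 𝒴) (n : ℕ)
    (x : Fin n → 𝒳) (y : Fin n → 𝒴) : ℝ := ∏ i, W.w (x i) (y i)

/-- `Y` is an output of `X` through `W^n`. -/
def IsOutput {𝒳 𝒴 : Type*} [Fintype 𝒴] {n : ℕ} (μ : PMF Ω)
    (X : Ω → Fin n → 𝒳) (Y : Ω → Fin n → 𝒴) (W : Channel 𝒳 𝒴) : Prop :=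
  ∀ x y, 0 < pr μ {ω | X ω = x} → cpr μ {ω | Y ω = y} {ω | X ω = x} = W.pn n x y

/-- `W^n(B|𝐱)`. -/
def imgMass {𝒳 𝒴 : Type*} [Fintype 𝒴] (W : Channel 𝒳 𝒴) (n : ℕ)
    (x : Fin n → 𝒳) (B : Finset (Fin n → 𝒴)) : ℝ := ∑ y ∈ B, W.pn n x y

/-- `B` is an `η`-image of `A` by `W`. -/
def IsImage {𝒳 𝒴 : Type*} [Fintype 𝒴] (W : Channel 𝒳 𝒴) (n : ℕ)
    (A : Set (Fin n → 𝒳)) (η : ℝ) (B : Finset (Fin n → 𝒴)) : Prop :=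
  ∀ x ∈ A, η ≤ imgMass W n x B

/-- Minimum cardinality of an `η`-image of `A` by `W`. -/
def gimg {𝒳 𝒴 : Type*} [Fintype 𝒴] (W : Channel 𝒳 𝒴) (n : ℕ)
    (A : Set (Fin n → 𝒳)) (η : ℝ) : ℕ :=
  sInf {k | ∃ B : Finset (Fin n → 𝒴), IsImage W n A η B ∧ B.card = k}

/-- `B` is an `η`-quasi-image of the pmf `P` by `W`. -/
def IsQImage {𝒳 𝒴 : Type*} [Fintype 𝒳] [Fintype 𝒴] (W : Channel 𝒳 𝒴) (n : ℕ)
    (P : (Fin n → 𝒳) → ℝ) (η : ℝ) (B : Finset (Fin n → 𝒴)) : Prop :=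
  η ≤ ∑ x, imgMass W n x B * P x

/-- Minimum cardinality of an `η`-quasi-image of `P` by `W`. -/
def gqimg {𝒳 𝒴 : Type*} [Fintype 𝒳] [Fintype 𝒴] (W : Channel 𝒳 𝒴) (n : ℕ)
    (P : (Fin n → 𝒳) → ℝ) (η : ℝ) : ℕ :=
  sInf {k | ∃ B : Finset (Fin n → 𝒴), IsQImage W n P η B ∧ B.card = k}

/-- The number of values in the support of `U`. -/
def suppCard {α : Type*} [Fintype α] (μ : PMF Ω) (U : Ω → α) : ℕ :=
  (Finset.univ.filter (fun u => 0 < pr μ {ω | U ω = u})).card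

/-- Mutual information (bits). -/
def MI {α β : Type*} [Fintype α] [Fintype β] (μ : PMF Ω) (A : Ω → α) (B : Ω → β) : ℝ :=
  ∑ a : α, ∑ b : β, pr μ {ω | A ω = a ∧ B ω = b} *
    Real.logb 2 (pr μ {ω | A ω = a ∧ B ω = b} / (pr μ {ω | A ω = a} * pr μ {ω | B ω = b}))

/-- Conditional mutual information (bits). -/
def CMI {α β γ : Type*} [Fintype α] [Fintype β] [Fintype γ] (μ : PMF Ω)
    (A : Ω → α) (B : Ω → β) (C : Ω → γ) : ℝ :=
  ∑ c : γ, pr μ {ω | C ω = c} * ∑ a : α, ∑ b : β,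
    cpr μ {ω | A ω = a ∧ B ω = b} {ω | C ω = c} *
      Real.logb 2 (cpr μ {ω | A ω = a ∧ B ω = b} {ω | C ω = c} /
        (cpr μ {ω | A ω = a} {ω | C ω = c} * cpr μ {ω | B ω = b} {ω | C ω = c}))

/-- `D_{wh}(w‖w'|p̂)` in the extended reals, with the stated conventions. -/
def Dkl {𝒳 𝒴 : Type*} [Fintype 𝒳] [Fintype 𝒴] (w w' wh : Channel 𝒳 𝒴)
    (p : 𝒳 → ℝ) : EReal :=
  if ∃ x y, 0 < wh.w x y * p x ∧ w'.w x y = 0 ∧ 0 < w.w x y then ⊤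
  else if ∃ x y, 0 < wh.w x y * p x ∧ w.w x y = 0 ∧ 0 < w'.w x y then ⊥
  else ((∑ x : 𝒳, ∑ y : 𝒴, wh.w x y * p x * Real.logb 2 (w.w x y / w'.w x y) : ℝ) : EReal)

/-- `sup { D_{wh}(w‖w'|p̂) }` over channels `wh` and pmfs `p̂` on `𝒳`. -/
def DklSup {𝒳 𝒴 : Type*} [Fintype 𝒳] [Fintype 𝒴] (w w' : Channel 𝒳 𝒴) : EReal :=
  sSup {d : EReal | ∃ (wh : Channel 𝒳 𝒴) (p : 𝒳 → ℝ),
    (∀ x, 0 ≤ p x) ∧ (∑ x, p x = 1) ∧ d = Dkl w w' wh p}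


theorem hammingDist_cons {β : Type*} {n : ℕ} (b b' : β) (z z' : Fin n → β) :
    hammingDist (Fin.cons b z : Fin (n + 1) → β) (Fin.cons b' z') =
      (if b ≠ b' then 1 else 0) + hammingDist z z' := by
  simp only [hammingDist, Finset.card_filter, Fin.sum_univ_succ, Fin.cons_zero, Fin.cons_succ]

theorem sum_cons {β : Type*} [Fintype β] {n : ℕ} (F : (Fin (n + 1) → β) → ℝ) :
    ∑ y, F y = ∑ b, ∑ z : Fin n → β, F (Fin.cons b z) := by
  rw [← (Fin.consEquiv (fun _ : Fin (n + 1) => β)).sum_comp, Fintype.sum_prod_type]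
  rfl

/-- Talagrand's exponential inequality for the Hamming distance to a set. -/
theorem exists_hammingDist_exp_bound {β : Type*} [Fintype β] (t : ℝ) (ht : 0 ≤ t) (n : ℕ) :
    ∀ p : Fin n → β → ℝ, (∀ i b, 0 ≤ p i b) → (∀ i, ∑ b, p i b = 1) →
    ∀ A : Finset (Fin n → β), A.Nonempty →
    ∃ d : (Fin n → β) → ℕ, (∀ y, ∃ a ∈ A, hammingDist y a ≤ d y) ∧
      (∑ y ∈ A, ∏ i, p i (y i)) * ∑ y, (∏ i, p i (y i)) * Real.exp (t * d y) ≤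
        ((2 + Real.exp t + Real.exp (-t)) / 4) ^ n := by
  induction n with
  | zero =>
    intro p _ _ A hA
    refine ⟨fun _ => 0, fun y => ?_, ?_⟩
    · obtain ⟨a, ha⟩ := hA
      exact ⟨a, ha, by simp [hammingDist]⟩
    · obtain ⟨a, ha⟩ := hA
      have hA' : A = Finset.univ :=
        Finset.eq_univ_of_forall fun z => by rwa [Subsingleton.elim z a]
      simp [hA']
  | succ n ih =>
    intro p hp hp1 A hA
    set K := (2 + Real.exp t + Real.exp (-t)) / 4 with hK
    have hK0 : 0 ≤ K := by positivity
    set q : Fin n → β → ℝ := fun i => p i.succ with hq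
    set Q : (Fin n → β) → ℝ := fun z => ∏ i, q i (z i) with hQ
    have hQ0 : ∀ z, 0 ≤ Q z := fun z => Finset.prod_nonneg fun i _ => hp _ _
    set S : β → Finset (Fin n → β) := fun b => Finset.univ.filter fun z => Fin.cons b z ∈ A with hS
    set B : Finset (Fin n → β) := Finset.univ.filter fun z => ∃ b, Fin.cons b z ∈ A with hB
    have hSB : ∀ b, S b ⊆ B := fun b z hz => by
      simp only [hS, hB, Finset.mem_filter, Finset.mem_univ, true_and] at hz ⊢
      exact ⟨b, hz⟩
    have hBne : B.Nonempty := by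
      obtain ⟨a, ha⟩ := hA
      refine ⟨Fin.tail a, ?_⟩
      simp only [hB, Finset.mem_filter, Finset.mem_univ, true_and]
      exact ⟨a 0, by simpa [Fin.cons_self_tail] using ha⟩
    obtain ⟨dB, hdB, hdB'⟩ := ih q (fun i => hp _) (fun i => hp1 _) B hBne
    have hex : ∀ b, ∃ d : (Fin n → β) → ℕ,
        (∀ z, ∃ a ∈ A, hammingDist (Fin.cons b z : Fin (n + 1) → β) a ≤ d z) ∧
        (∀ z, d z ≤ 1 + dB z) ∧
        (∑ z ∈ S b, Q z) * ∑ z, Q z * Real.exp (t * d z) ≤ K ^ n := by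
      intro b
      have key : ∀ z, ∃ a ∈ A, hammingDist (Fin.cons b z : Fin (n + 1) → β) a ≤ 1 + dB z := by
        intro z
        obtain ⟨a, ha, had⟩ := hdB z
        simp only [hB, Finset.mem_filter, Finset.mem_univ, true_and] at ha
        obtain ⟨b', hb'⟩ := ha
        refine ⟨_, hb', ?_⟩
        rw [hammingDist_cons]
        split_ifs <;> omega
      by_cases hne : (S b).Nonempty
      · obtain ⟨dS, hdS, hdS'⟩ := ih q (fun i => hp _) (fun i => hp1 _) (S b) hne
        refine ⟨fun z => min (dS z) (1 + dB z), fun z => ?_, fun z => min_le_right _ _, ?_⟩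
        · beta_reduce
          rcases le_total (dS z) (1 + dB z) with h | h
          · rw [min_eq_left h]
            obtain ⟨a, ha, had⟩ := hdS z
            simp only [hS, Finset.mem_filter, Finset.mem_univ, true_and] at ha
            refine ⟨_, ha, ?_⟩
            rw [hammingDist_cons]
            simpa using had
          · rw [min_eq_right h]
            exact key z
        · refine le_trans (mul_le_mul_of_nonneg_left ?_ (Finset.sum_nonneg fun z _ => hQ0 z)) hdS'
          refine Finset.sum_le_sum fun z _ => mul_le_mul_of_nonneg_left ?_ (hQ0 z)
          refine Real.exp_le_exp.2 (mul_le_mul_of_nonneg_left ?_ ht)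
          exact_mod_cast min_le_left _ _
      · refine ⟨fun z => 1 + dB z, key, fun z => le_rfl, ?_⟩
        rw [Finset.not_nonempty_iff_eq_empty.1 hne]
        simp only [Finset.sum_empty, zero_mul]
        positivity
    choose d hdA hd1 hdS using hex
    refine ⟨fun y => d (y 0) (Fin.tail y), fun y => ?_, ?_⟩
    · have := hdA (y 0) (Fin.tail y)
      rwa [Fin.cons_self_tail] at this
    set b₀ := ∑ z ∈ B, Q z with hb₀
    set a : β → ℝ := fun b => ∑ z ∈ S b, Q z with ha
    set e : β → ℝ := fun b => ∑ z, Q z * Real.exp (t * d b z) with he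
    have hab : ∀ b, a b ≤ b₀ := fun b =>
      Finset.sum_le_sum_of_subset_of_nonneg (hSB b) fun z _ _ => hQ0 z
    have ha0 : ∀ b, 0 ≤ a b := fun b => Finset.sum_nonneg fun z _ => hQ0 z
    have hb0 : 0 ≤ b₀ := Finset.sum_nonneg fun z _ => hQ0 z
    have h1 : ∑ y ∈ A, ∏ i, p i (y i) = ∑ b, p 0 b * a b := by
      have hite : ∑ y ∈ A, ∏ i, p i (y i) = ∑ y, if y ∈ A then ∏ i, p i (y i) else 0 := by
        simp [Finset.sum_ite_mem]
      rw [hite, sum_cons]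
      refine Finset.sum_congr rfl fun b _ => ?_
      simp only [ha, hS, Finset.mul_sum, Finset.sum_filter]
      refine Finset.sum_congr rfl fun z _ => ?_
      split_ifs <;> simp [Fin.prod_univ_succ, hQ, hq]
    have h2 : ∑ y : Fin (n + 1) → β, (∏ i, p i (y i)) * Real.exp (t * (d (y 0) (Fin.tail y) : ℕ)) =
        ∑ b, p 0 b * e b := by
      rw [sum_cons]
      refine Finset.sum_congr rfl fun b _ => ?_
      simp only [he, Finset.mul_sum]
      refine Finset.sum_congr rfl fun z _ => ?_
      simp [Fin.prod_univ_succ, hQ, hq, mul_assoc]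
    rw [h1, h2]
    rcases hb0.eq_or_lt with h0 | hpos
    · have : ∀ b, a b = 0 := fun b => le_antisymm (h0 ▸ hab b) (ha0 b)
      simp only [this, mul_zero, Finset.sum_const_zero, zero_mul]
      positivity
    have hKn : 0 ≤ K ^ n := by positivity
    have heB : ∀ b, b₀ * e b ≤ Real.exp t * K ^ n := by
      intro b
      refine le_trans ?_ (mul_le_mul_of_nonneg_left hdB' (Real.exp_pos t).le)
      rw [mul_left_comm]
      refine mul_le_mul_of_nonneg_left ?_ hb0
      rw [Finset.mul_sum]
      refine Finset.sum_le_sum fun z _ => ?_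
      rw [mul_left_comm, ← Real.exp_add]
      refine mul_le_mul_of_nonneg_left ?_ (hQ0 z)
      refine Real.exp_le_exp.2 ?_
      have : ((d b z : ℕ) : ℝ) ≤ 1 + dB z := by exact_mod_cast hd1 b z
      nlinarith
    have het : 1 ≤ Real.exp t := Real.one_le_exp ht
    have hkey : ∀ b, b₀ ^ 2 * e b ≤ K ^ n * ((1 + Real.exp t) * b₀ - Real.exp t * a b) := by
      intro b
      have h3 := heB b
      have h4 := hdS b
      change a b * e b ≤ K ^ n at h4
      have e0 : 0 ≤ e b := Finset.sum_nonneg fun z _ => mul_nonneg (hQ0 z) (Real.exp_pos _).le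
      rcases le_total (Real.exp t * a b) b₀ with h5 | h5
      · nlinarith [mul_le_mul_of_nonneg_left h3 hb0, mul_nonneg hKn (sub_nonneg.2 h5)]
      · have ap : 0 < a b := by
          by_contra h
          have : a b = 0 := le_antisymm (not_lt.1 h) (ha0 b)
          rw [this] at h5; simp at h5; linarith
        have h6 : 0 ≤ (b₀ - a b) * (Real.exp t * a b - b₀) :=
          mul_nonneg (sub_nonneg.2 (hab b)) (sub_nonneg.2 h5)
        refine le_of_mul_le_mul_left ?_ ap
        calc a b * (b₀ ^ 2 * e b) = b₀ ^ 2 * (a b * e b) := by ring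
          _ ≤ b₀ ^ 2 * K ^ n := by gcongr
          _ ≤ _ := by nlinarith [mul_nonneg hKn h6]
    set m := ∑ b, p 0 b * a b with hm
    have hsum : b₀ ^ 2 * ∑ b, p 0 b * e b ≤ K ^ n * ((1 + Real.exp t) * b₀ - Real.exp t * m) := by
      have : ∑ b, p 0 b * (K ^ n * ((1 + Real.exp t) * b₀ - Real.exp t * a b)) =
          K ^ n * ((1 + Real.exp t) * b₀ - Real.exp t * m) := by
        calc _ = ∑ b, (p 0 b * (K ^ n * ((1 + Real.exp t) * b₀)) -
              K ^ n * Real.exp t * (p 0 b * a b)) :=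
              Finset.sum_congr rfl fun b _ => by ring
          _ = _ := by
            rw [Finset.sum_sub_distrib, ← Finset.sum_mul, ← Finset.mul_sum, hp1 0]
            ring
      rw [← this, Finset.mul_sum]
      refine Finset.sum_le_sum fun b _ => ?_
      rw [mul_left_comm]
      exact mul_le_mul_of_nonneg_left (hkey b) (hp 0 b)
    have hm0 : 0 ≤ m := Finset.sum_nonneg fun b _ => mul_nonneg (hp 0 b) (ha0 b)
    have hb2 : 0 < b₀ ^ 2 := by positivity
    refine le_of_mul_le_mul_left ?_ hb2
    have hquad : m * ((1 + Real.exp t) * b₀ - Real.exp t * m) ≤ b₀ ^ 2 * K := by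
      have hinv : Real.exp t * Real.exp (-t) = 1 := by rw [← Real.exp_add]; simp
      refine le_of_mul_le_mul_left ?_ (Real.exp_pos t)
      have : Real.exp t * (b₀ ^ 2 * K) = b₀ ^ 2 * (1 + Real.exp t) ^ 2 / 4 := by
        rw [hK]; linear_combination b₀ ^ 2 / 4 * hinv
      rw [this]
      nlinarith [sq_nonneg (b₀ * (1 + Real.exp t) - 2 * Real.exp t * m)]
    calc b₀ ^ 2 * (m * ∑ b, p 0 b * e b) = m * (b₀ ^ 2 * ∑ b, p 0 b * e b) := by ring
      _ ≤ m * (K ^ n * ((1 + Real.exp t) * b₀ - Real.exp t * m)) := by gcongr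
      _ = K ^ n * (m * ((1 + Real.exp t) * b₀ - Real.exp t * m)) := by ring
      _ ≤ K ^ n * (b₀ ^ 2 * K) := by gcongr
      _ = b₀ ^ 2 * K ^ (n + 1) := by ring
theorem sum_prod_eq_prod_sum {β : Type*} [Fintype β] {n : ℕ} (F : Fin n → β → ℝ) :
    ∑ y : Fin n → β, ∏ i, F i (y i) = ∏ i, ∑ b, F i b := by
  rw [Finset.prod_univ_sum, Fintype.piFinset_univ]

/-- The set of words within Hamming distance `r` of `A`. -/
def nbhd {β : Type*} [Fintype β] {n : ℕ} (A : Finset (Fin n → β)) (r : ℝ) :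
    Finset (Fin n → β) :=
  Finset.univ.filter fun y => ∃ a ∈ A, (hammingDist y a : ℝ) ≤ r

theorem card_nbhd_le {β : Type*} [Fintype β] {n : ℕ} (A : Finset (Fin n → β)) (r s : ℝ)
    (hs : 0 < s) (hs1 : s ≤ 1) :
    ((nbhd A r).card : ℝ) ≤ A.card * (s ^ (-r) * (1 + Fintype.card β * s) ^ n) := by
  have hsub : nbhd A r ⊆
      A.biUnion fun a => Finset.univ.filter fun y => (hammingDist y a : ℝ) ≤ r := by
    intro y hy
    simpa [nbhd] using hy
  have hball : ∀ a : Fin n → β,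
      ((Finset.univ.filter fun y => (hammingDist y a : ℝ) ≤ r).card : ℝ) ≤
        s ^ (-r) * (1 + Fintype.card β * s) ^ n := by
    intro a
    have hprod : ∀ y : Fin n → β,
        s ^ hammingDist y a = ∏ i, (if y i ≠ a i then s else 1) := by
      intro y
      rw [hammingDist, Finset.prod_ite]
      simp
    have hsum : ∑ y : Fin n → β, s ^ hammingDist y a ≤ (1 + Fintype.card β * s) ^ n := by
      simp only [hprod]
      rw [sum_prod_eq_prod_sum (fun i b => if b ≠ a i then s else 1)]
      calc ∏ i, ∑ b, (if b ≠ a i then s else 1)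
          ≤ ∏ _i : Fin n, (1 + Fintype.card β * s) := by
            refine Finset.prod_le_prod (fun i _ => Finset.sum_nonneg fun b _ => ?_) fun i _ => ?_
            · split_ifs <;> linarith
            · calc ∑ b, (if b ≠ a i then s else 1) ≤ ∑ b, ((if b = a i then 1 else 0) + s) := by
                    refine Finset.sum_le_sum fun b _ => ?_
                    by_cases h : b = a i <;> simp [h, hs.le]
                _ = _ := by simp [Finset.sum_add_distrib]
        _ = _ := by simp
    calc ((Finset.univ.filter fun y => (hammingDist y a : ℝ) ≤ r).card : ℝ)
        = ∑ y ∈ Finset.univ.filter (fun y => (hammingDist y a : ℝ) ≤ r), (1 : ℝ) := by simp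
      _ ≤ ∑ y ∈ Finset.univ.filter (fun y => (hammingDist y a : ℝ) ≤ r),
            s ^ (-r) * s ^ hammingDist y a := by
          refine Finset.sum_le_sum fun y hy => ?_
          rw [← Real.rpow_natCast, ← Real.rpow_add hs]
          refine Real.one_le_rpow_of_pos_of_le_one_of_nonpos hs hs1 ?_
          have := (Finset.mem_filter.1 hy).2
          linarith
      _ ≤ ∑ y, s ^ (-r) * s ^ hammingDist y a :=
          Finset.sum_le_sum_of_subset_of_nonneg (Finset.subset_univ _) fun y _ _ => by positivity
      _ = s ^ (-r) * ∑ y, s ^ hammingDist y a := by rw [Finset.mul_sum]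
      _ ≤ _ := by gcongr
  calc ((nbhd A r).card : ℝ) ≤ ∑ a ∈ A,
        ((Finset.univ.filter fun y => (hammingDist y a : ℝ) ≤ r).card : ℝ) := by
        exact_mod_cast (Finset.card_le_card hsub).trans Finset.card_biUnion_le
    _ ≤ ∑ _a ∈ A, s ^ (-r) * (1 + Fintype.card β * s) ^ n :=
        Finset.sum_le_sum fun a _ => hball a
    _ = _ := by simp

section Channel

variable {𝒳 𝒴 : Type*} [Fintype 𝒴] (W : Channel 𝒳 𝒴) {n : ℕ}

theorem Channel.pn_nonneg (x : Fin n → 𝒳) (y : Fin n → 𝒴) : 0 ≤ W.pn n x y :=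
  Finset.prod_nonneg fun _ _ => W.nonneg _ _

theorem imgMass_univ (x : Fin n → 𝒳) : imgMass W n x Finset.univ = 1 := by
  simp only [imgMass, Channel.pn]
  rw [sum_prod_eq_prod_sum (fun i b => W.w (x i) b)]
  simp [W.sum_one]

/-- The blowing-up lemma. -/
theorem imgMass_compl_nbhd_le (x : Fin n → 𝒳) (A : Finset (Fin n → 𝒴)) (α : ℝ) (hα : 0 < α)
    (hA : (2 : ℝ) ^ (-(n : ℝ) * α) ≤ imgMass W n x A) :
    imgMass W n x (nbhd A (2 * n * √α))ᶜ ≤ (2 : ℝ) ^ (-(n : ℝ) * α) := by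
  have hτ : (0 : ℝ) < 2 ^ (-(n : ℝ) * α) := by positivity
  have hne : A.Nonempty := by
    rw [Finset.nonempty_iff_ne_empty]
    rintro rfl
    simp only [imgMass, Finset.sum_empty] at hA
    linarith
  obtain ⟨d, hd, hexp⟩ := exists_hammingDist_exp_bound (√α) (Real.sqrt_nonneg _) n
    (fun i b => W.w (x i) b) (fun i b => W.nonneg _ _) (fun i => W.sum_one _) A hne
  set t := √α with ht
  have ht0 : 0 ≤ t := Real.sqrt_nonneg _
  have htt : t * t = α := Real.mul_self_sqrt hα.le
  have hcosh : (2 + Real.exp t + Real.exp (-t)) / 4 ≤ Real.exp (α / 2) := by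
    have h1 := Real.cosh_le_exp_half_sq t
    have h2 : t ^ 2 = α := by rw [sq, htt]
    rw [h2, Real.cosh_eq] at h1
    have h3 : 1 ≤ Real.exp (α / 2) := Real.one_le_exp (by positivity)
    linarith
  have hcompl : imgMass W n x (nbhd A (2 * n * t))ᶜ * Real.exp (2 * n * α) ≤
      ∑ y, W.pn n x y * Real.exp (t * d y) := by
    rw [imgMass, Finset.sum_mul]
    refine (Finset.sum_le_sum fun y hy => ?_).trans
      (Finset.sum_le_sum_of_subset_of_nonneg (Finset.subset_univ (nbhd A (2 * n * t))ᶜ)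
        fun y _ _ => mul_nonneg (W.pn_nonneg x y) (Real.exp_pos _).le)
    refine mul_le_mul_of_nonneg_left (Real.exp_le_exp.2 ?_) (W.pn_nonneg x y)
    obtain ⟨a, ha, had⟩ := hd y
    have hy' : 2 * n * t < hammingDist y a := by
      by_contra h
      exact (Finset.mem_compl.1 hy) (by
        simp only [nbhd, Finset.mem_filter, Finset.mem_univ, true_and]
        exact ⟨a, ha, not_lt.1 h⟩)
    have h4 : (hammingDist y a : ℝ) ≤ d y := by exact_mod_cast had
    calc 2 * n * α = t * (2 * n * t) := by rw [← htt]; ring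
      _ ≤ t * d y := mul_le_mul_of_nonneg_left (by linarith) ht0
  have hm0 : 0 ≤ imgMass W n x (nbhd A (2 * n * t))ᶜ :=
    Finset.sum_nonneg fun y _ => W.pn_nonneg x y
  have hK : ((2 + Real.exp t + Real.exp (-t)) / 4) ^ n ≤ Real.exp (n * (α / 2)) := by
    rw [Real.exp_nat_mul]
    exact pow_le_pow_left₀ (by positivity) hcosh n
  have hall : (2 : ℝ) ^ (-(n : ℝ) * α) *
      (imgMass W n x (nbhd A (2 * n * t))ᶜ * Real.exp (2 * n * α)) ≤ Real.exp (n * (α / 2)) := by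
    refine le_trans ?_ (hexp.trans hK)
    exact mul_le_mul hA hcompl (by positivity) (hτ.le.trans hA)
  have h2exp : (2 : ℝ) ^ (-(n : ℝ) * α) = Real.exp (-(Real.log 2 * (n * α))) := by
    rw [Real.rpow_def_of_pos (by norm_num)]
    congr 1
    ring
  rw [h2exp] at hall ⊢
  have hl : Real.log 2 < 0.7 := Real.log_two_lt_d9.trans (by norm_num)
  have hnα : 0 ≤ n * α := by positivity
  refine le_of_mul_le_mul_left (a := Real.exp (-(Real.log 2 * (n * α))) * Real.exp (2 * n * α))
    ?_ (by positivity)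
  calc _ = Real.exp (-(Real.log 2 * (n * α))) *
        (imgMass W n x (nbhd A (2 * n * t))ᶜ * Real.exp (2 * n * α)) := by ring
    _ ≤ Real.exp (n * (α / 2)) := hall
    _ ≤ _ := by
      rw [← Real.exp_add, ← Real.exp_add]
      refine Real.exp_le_exp.2 ?_
      nlinarith

end Channel

section Probability

variable (μ : PMF Ω)

theorem pr_eq_real (E : Set Ω) : pr μ E = (@PMF.toMeasure Ω ⊤ μ).real E := by
  let _ : MeasurableSpace Ω := ⊤
  rw [pr, MeasureTheory.measureReal_def,
    PMF.toMeasure_apply_eq_toOuterMeasure_apply _ MeasurableSpace.measurableSet_top]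

theorem pr_nonneg (E : Set Ω) : 0 ≤ pr μ E := ENNReal.toReal_nonneg

theorem pr_mono {E F : Set Ω} (h : E ⊆ F) : pr μ E ≤ pr μ F := by
  let _ : MeasurableSpace Ω := ⊤
  rw [pr_eq_real, pr_eq_real]
  exact MeasureTheory.measureReal_mono h

theorem pr_univ : pr μ Set.univ = 1 := by
  let _ : MeasurableSpace Ω := ⊤
  rw [pr_eq_real]
  simp

theorem pr_le_one (E : Set Ω) : pr μ E ≤ 1 :=
  pr_univ μ ▸ pr_mono μ (Set.subset_univ E)

theorem pr_union_le (E F : Set Ω) : pr μ (E ∪ F) ≤ pr μ E + pr μ F := by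
  let _ : MeasurableSpace Ω := ⊤
  simp only [pr_eq_real]
  exact MeasureTheory.measureReal_union_le E F

theorem pr_compl (E : Set Ω) : pr μ Eᶜ = 1 - pr μ E := by
  let _ : MeasurableSpace Ω := ⊤
  simp only [pr_eq_real]
  exact MeasureTheory.probReal_compl_eq_one_sub trivial

theorem pr_eq_sum_fiber {κ : Type*} [Fintype κ] (Z : Ω → κ) (E : Set Ω) :
    pr μ E = ∑ z, pr μ {ω | ω ∈ E ∧ Z ω = z} := by
  let _ : MeasurableSpace Ω := ⊤
  simp only [pr_eq_real]
  rw [← MeasureTheory.measureReal_biUnion_finset]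
  · congr 1
    ext ω
    simp
  · intro a _ b _ hab
    refine Set.disjoint_left.2 fun ω h h' => hab (h.2.symm.trans h'.2)
  · intro _ _
    trivial

theorem pr_preimage {κ : Type*} [Fintype κ] (Z : Ω → κ) (S : κ → Prop) :
    pr μ {ω | S (Z ω)} = ∑ z, if S z then pr μ {ω | Z ω = z} else 0 := by
  rw [pr_eq_sum_fiber μ Z]
  refine Finset.sum_congr rfl fun z _ => ?_
  split_ifs with h
  · congr 1
    ext ω
    simp only [Set.mem_ofPred_eq]
    exact ⟨fun h => h.2, fun h' => ⟨h' ▸ h, h'⟩⟩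
  · have : {ω | ω ∈ {ω | S (Z ω)} ∧ Z ω = z} = ∅ := by
      ext ω
      simp only [Set.mem_ofPred_eq, Set.mem_empty_iff_false, iff_false]
      rintro ⟨h1, rfl⟩
      exact h h1
    rw [this]
    simp [pr]

theorem cpr_nonneg (E F : Set Ω) : 0 ≤ cpr μ E F := div_nonneg (pr_nonneg _ _) (pr_nonneg _ _)

theorem cpr_le_one (E F : Set Ω) : cpr μ E F ≤ 1 :=
  div_le_one_of_le₀ (pr_mono μ Set.inter_subset_right) (pr_nonneg _ _)

theorem sum_cpr_le_one {κ : Type*} [Fintype κ] (Z : Ω → κ) (F : Set Ω) :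
    ∑ z, cpr μ {ω | Z ω = z} F ≤ 1 := by
  simp only [cpr, ← Finset.sum_div]
  refine div_le_one_of_le₀ (le_of_eq ?_) (pr_nonneg _ _)
  rw [pr_eq_sum_fiber μ Z F]
  refine Finset.sum_congr rfl fun z _ => congrArg _ ?_
  ext ω
  exact and_comm

/-- At most `2 ^ k` values have conditional probability at least `2 ^ (-k)`. -/
theorem card_le_of_cpr {κ : Type*} [Fintype κ] (Z : Ω → κ) (F : Set Ω) (k : ℝ) :
    ((Finset.univ.filter fun z => (2 : ℝ) ^ (-k) ≤ cpr μ {ω | Z ω = z} F).card : ℝ) ≤ 2 ^ k := by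
  set A := Finset.univ.filter fun z => (2 : ℝ) ^ (-k) ≤ cpr μ {ω | Z ω = z} F
  have h : (A.card : ℝ) * 2 ^ (-k) ≤ 1 := by
    calc (A.card : ℝ) * 2 ^ (-k) = ∑ _z ∈ A, (2 : ℝ) ^ (-k) := by simp
      _ ≤ ∑ z ∈ A, cpr μ {ω | Z ω = z} F :=
        Finset.sum_le_sum fun z hz => (Finset.mem_filter.1 hz).2
      _ ≤ ∑ z, cpr μ {ω | Z ω = z} F :=
        Finset.sum_le_sum_of_subset_of_nonneg (Finset.subset_univ _)
          fun z _ _ => cpr_nonneg _ _ _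
      _ ≤ 1 := sum_cpr_le_one μ Z F
  rw [Real.rpow_neg (by norm_num)] at h
  have h2 : (0 : ℝ) < 2 ^ k := by positivity
  rwa [← div_eq_mul_inv, div_le_one h2] at h

theorem pr_le_of_joint_le {κ ι : Type*} [Fintype κ] [Fintype ι] (Z : Ω → κ) (Y : Ω → ι)
    (S : κ → Prop) (G : κ → Finset ι) (t N : ℝ) (ht : 0 ≤ t) (hN : ∀ z, ((G z).card : ℝ) ≤ N) :
    pr μ {ω | S (Z ω) ∧ Y ω ∈ G (Z ω) ∧
        pr μ {ω' | Z ω' = Z ω ∧ Y ω' = Y ω} ≤ t * pr μ {ω' | Z ω' = Z ω}} ≤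
      t * N * pr μ {ω | S (Z ω)} := by
  rw [pr_preimage μ Z S, pr_preimage μ (fun ω => (Z ω, Y ω)) (fun p => S p.1 ∧ p.2 ∈ G p.1 ∧
    pr μ {ω' | Z ω' = p.1 ∧ Y ω' = p.2} ≤ t * pr μ {ω' | Z ω' = p.1}), Fintype.sum_prod_type,
    Finset.mul_sum]
  refine Finset.sum_le_sum fun z _ => ?_
  by_cases hS : S z
  · simp only [hS, true_and, if_true, Prod.mk.injEq]
    calc _ ≤ ∑ y, if y ∈ G z then t * pr μ {ω | Z ω = z} else 0 := by
          refine Finset.sum_le_sum fun y _ => ?_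
          have := mul_nonneg ht (pr_nonneg μ {ω | Z ω = z})
          split_ifs with h1 h2 h2
          · exact h1.2
          · exact absurd h1.1 h2
          · exact this
          · exact le_rfl
      _ = (G z).card * (t * pr μ {ω | Z ω = z}) := by simp [Finset.sum_ite_mem]
      _ ≤ N * (t * pr μ {ω | Z ω = z}) :=
          mul_le_mul_of_nonneg_right (hN z) (mul_nonneg ht (pr_nonneg _ _))
      _ = _ := by ring
  · simp [hS]

theorem pr_le_of_likelihood_le {κ : Type*} [Fintype κ] (M : Ω → κ) (E : Set Ω) (t : ℝ)
    (ht : 0 ≤ t) :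
    pr μ {ω | ω ∈ E ∧ pr μ {ω' | ω' ∈ E ∧ M ω' = M ω} ≤ t * pr μ {ω' | M ω' = M ω}} ≤ t := by
  have h1 : ∑ m, pr μ {ω | M ω = m} = 1 := by
    have := pr_preimage μ M (fun _ => True)
    simp only [if_true] at this
    rw [← this, ← pr_univ μ]
    rfl
  calc _ ≤ ∑ m, t * pr μ {ω | M ω = m} := by
        rw [pr_eq_sum_fiber μ M]
        refine Finset.sum_le_sum fun m _ => ?_
        by_cases h : pr μ {ω' | ω' ∈ E ∧ M ω' = m} ≤ t * pr μ {ω' | M ω' = m}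
        · refine le_trans (pr_mono μ ?_) h
          rintro ω ⟨⟨h1, -⟩, h2⟩
          exact ⟨h1, h2⟩
        · refine le_trans (le_of_eq ?_) (mul_nonneg ht (pr_nonneg μ {ω' | M ω' = m}))
          convert (show pr μ ∅ = 0 by simp [pr]) using 2
          ext ω
          simp only [Set.mem_ofPred_eq, Set.mem_empty_iff_false, iff_false]
          rintro ⟨⟨-, h1⟩, rfl⟩
          exact h h1
    _ = t := by rw [← Finset.mul_sum, h1, mul_one]

variable {𝒳 𝒴 κ : Type*} [Fintype 𝒴] {n : ℕ}
  {X : Ω → Fin n → 𝒳} {Y : Ω → Fin n → 𝒴} {W : Channel 𝒳 𝒴} {Z : Ω → κ}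

theorem pr_joint_eq {μ : PMF Ω} (hM : Markov μ Z X Y) (hO : IsOutput μ X Y W) (z : κ)
    (x : Fin n → 𝒳) (y : Fin n → 𝒴) :
    pr μ {ω | Z ω = z ∧ X ω = x ∧ Y ω = y} = pr μ {ω | Z ω = z ∧ X ω = x} * W.pn n x y := by
  rcases (pr_nonneg μ {ω | X ω = x}).eq_or_lt with h | h
  · have h1 : pr μ {ω | Z ω = z ∧ X ω = x} ≤ 0 := h ▸ pr_mono μ fun ω h => h.2
    have h2 : pr μ {ω | Z ω = z ∧ X ω = x ∧ Y ω = y} ≤ 0 := h ▸ pr_mono μ fun ω h => h.2.1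
    rw [le_antisymm h1 (pr_nonneg _ _), le_antisymm h2 (pr_nonneg _ _), zero_mul]
  · have h1 := hO x y h
    rw [cpr, div_eq_iff h.ne'] at h1
    have h2 : {ω | X ω = x ∧ Y ω = y} = {ω | Y ω = y} ∩ {ω | X ω = x} := by
      ext ω
      exact and_comm
    have h3 := hM z x y
    rw [h2, h1, ← mul_assoc] at h3
    exact mul_right_cancel₀ h.ne' h3

theorem pr_le_of_imgMass_le [Fintype 𝒳] [Fintype κ] {μ : PMF Ω} (hM : Markov μ Z X Y) (hO : IsOutput μ X Y W)
    (S : κ → (Fin n → 𝒳) → Prop) (G : κ → Finset (Fin n → 𝒴)) (t : ℝ)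
    (hG : ∀ z x, S z x → imgMass W n x (G z) ≤ t) :
    pr μ {ω | S (Z ω) (X ω) ∧ Y ω ∈ G (Z ω)} ≤ t * pr μ {ω | S (Z ω) (X ω)} := by
  rw [pr_preimage μ (fun ω => (Z ω, X ω)) (fun p => S p.1 p.2),
    pr_preimage μ (fun ω => ((Z ω, X ω), Y ω)) (fun p => S p.1.1 p.1.2 ∧ p.2 ∈ G p.1.1),
    Fintype.sum_prod_type, Finset.mul_sum]
  refine Finset.sum_le_sum fun p _ => ?_
  obtain ⟨z, x⟩ := p
  by_cases hS : S z x
  · simp only [hS, true_and, if_true, Prod.mk.injEq, and_assoc, pr_joint_eq hM hO]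
    rw [Finset.sum_ite_mem, Finset.univ_inter, ← Finset.mul_sum, mul_comm]
    exact mul_le_mul_of_nonneg_right (hG z x hS) (pr_nonneg _ _)
  · simp [hS]

end Probability

section Spectrum

variable {𝒳 𝒴 𝓜 𝒰 : Type*} [Fintype 𝒳] [Fintype 𝒴] [Fintype 𝓜] [Fintype 𝒰] {n : ℕ}
  {μ : PMF Ω} {M : Ω → 𝓜} {X : Ω → Fin n → 𝒳} {Y : Ω → Fin n → 𝒴} {U : Ω → 𝒰}
  {W : Channel 𝒳 𝒴}

/-- The values of `Y` whose conditional probability given `M = m` is at least `2 ^ (-k)`. -/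
def likely {ι κ : Type*} [Fintype ι] (μ : PMF Ω) (M : Ω → κ) (Y : Ω → ι) (k : ℝ) (m : κ) :
    Finset ι :=
  Finset.univ.filter fun y => (2 : ℝ) ^ (-k) ≤ cpr μ {ω | Y ω = y} {ω | M ω = m}

theorem notMem_likely {ι κ : Type*} [Fintype ι] {μ : PMF Ω} {M : Ω → κ} {Y : Ω → ι} {k : ℝ}
    {m : κ} {y : ι} :
    y ∉ likely μ M Y k m ↔ cpr μ {ω | Y ω = y} {ω | M ω = m} < 2 ^ (-k) := by
  rw [likely, Finset.mem_filter, and_iff_right (Finset.mem_univ y), not_le]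

theorem pr_le_of_likely_mass_le (hM : Markov μ M X Y) (hO : IsOutput μ X Y W)
    (S : 𝓜 → (Fin n → 𝒳) → Prop) (k : ℝ)
    (hS : ∀ m x, S m x → imgMass W n x (likely μ M Y k m) ≤ 1 / 2) :
    pr μ {ω | S (M ω) (X ω)} ≤ 2 * ((Fintype.card 𝒴 : ℝ) ^ n * 2 ^ (-k)) := by
  have h1 := pr_le_of_imgMass_le hM hO S (likely μ M Y k) (1 / 2) hS
  have ht : (0 : ℝ) ≤ 2 ^ (-k) := by positivity
  have h2 := pr_le_of_joint_le μ M Y (fun _ => True) (fun _ => Finset.univ) (2 ^ (-k))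
    ((Fintype.card 𝒴 : ℝ) ^ n) ht (fun m => by simp)
  have h3 : {ω | S (M ω) (X ω)} ⊆ {ω | S (M ω) (X ω) ∧ Y ω ∈ likely μ M Y k (M ω)} ∪
      {ω | True ∧ Y ω ∈ Finset.univ ∧ pr μ {ω' | M ω' = M ω ∧ Y ω' = Y ω} ≤
        2 ^ (-k) * pr μ {ω' | M ω' = M ω}} := by
    intro ω hω
    by_cases hY : Y ω ∈ likely μ M Y k (M ω)
    · exact Or.inl ⟨hω, hY⟩
    · refine Or.inr ⟨trivial, Finset.mem_univ _, ?_⟩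
      rw [notMem_likely, cpr] at hY
      have hset : {ω' | M ω' = M ω ∧ Y ω' = Y ω} =
          {ω' | Y ω' = Y ω} ∩ {ω' | M ω' = M ω} := by
        ext ω'
        exact and_comm
      rw [hset]
      rcases (pr_nonneg μ {ω' | M ω' = M ω}).eq_or_lt with h | h
      · rw [← h, mul_zero, h]
        exact pr_mono μ Set.inter_subset_right
      · exact ((div_lt_iff₀ h).1 hY).le
  have h4 := (pr_mono μ h3).trans (pr_union_le μ _ _)
  have h5 : 2 ^ (-k) * (Fintype.card 𝒴 : ℝ) ^ n * pr μ {ω : Ω | True} ≤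
      2 ^ (-k) * (Fintype.card 𝒴 : ℝ) ^ n :=
    mul_le_of_le_one_right (by positivity) (pr_le_one μ _)
  linarith

theorem cpr_spectrum_deviation_lt (hUM : Markov μ (fun ω => (U ω, M ω)) X Y)
    (hO : IsOutput μ X Y W) (S : 𝓜 → (Fin n → 𝒳) → Prop) (u : 𝒰)
    (hu : 0 < pr μ {ω | U ω = u}) (hS : pr μ {ω | U ω = u ∧ ¬ S (M ω) (X ω)} = 0)
    (v : ℕ) (a e D : ℝ) (ha : 1 ≤ a) (hD : e + 2 * a ≤ D) (hDlow : 1 + a ≤ D)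
    (G : 𝓜 → Finset (Fin n → 𝒴)) (hcard : ∀ m, ((G m).card : ℝ) ≤ 2 ^ (v + e))
    (hup : ∀ m x, S m x → imgMass W n x (G m)ᶜ ≤ 2 ^ (-a))
    (hlow : ∀ m x, S m x → 0 < v → imgMass W n x (likely μ M Y (v - 1) m) ≤ 2 ^ (-a)) :
    cpr μ {ω | |(- Real.logb 2 (cpr μ {ω' | Y ω' = Y ω}
        ({ω' | U ω' = U ω} ∩ {ω' | M ω' = M ω}))) - v| > D + hs μ U u} {ω | U ω = u} <
      4 * 2 ^ (-a) := by
  set τ : ℝ := 2 ^ (-a) with hτ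
  have hτ0 : 0 < τ := by positivity
  have hτ2 : τ ≤ 1 / 2 := by
    calc τ ≤ (2 : ℝ) ^ (-1 : ℝ) :=
          Real.rpow_le_rpow_of_exponent_le (by norm_num) (by linarith)
      _ = 1 / 2 := by rw [Real.rpow_neg_one]; norm_num
  set P := pr μ {ω | U ω = u} with hP
  have hhs : 0 ≤ hs μ U u :=
    neg_nonneg.2 (Real.logb_nonpos (by norm_num) hu.le (pr_le_one _ _))
  set B1 : Set Ω := {ω | ω ∈ {ω | U ω = u} ∧
    pr μ {ω' | ω' ∈ {ω | U ω = u} ∧ M ω' = M ω} ≤ τ * P * pr μ {ω' | M ω' = M ω}} with hB1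
  set B2 : Set Ω := {ω | ((U ω, M ω).1 = u ∧ 0 < v ∧ S (U ω, M ω).2 (X ω)) ∧
    Y ω ∈ likely μ M Y (v - 1) (U ω, M ω).2} with hB2
  set B3 : Set Ω := {ω | ((U ω, M ω).1 = u ∧ S (U ω, M ω).2 (X ω)) ∧
    Y ω ∈ (G (U ω, M ω).2)ᶜ} with hB3
  set t : ℝ := 2 ^ (-(v + D)) with ht
  set B4 : Set Ω := {ω | (U ω, M ω).1 = u ∧ Y ω ∈ G (U ω, M ω).2 ∧
    pr μ {ω' | (U ω', M ω') = (U ω, M ω) ∧ Y ω' = Y ω} ≤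
      t * pr μ {ω' | (U ω', M ω') = (U ω, M ω)}} with hB4
  have b1 : pr μ B1 ≤ τ * P := pr_le_of_likelihood_le μ M _ _ (by positivity)
  have b2 : pr μ B2 ≤ τ * P := by
    refine (pr_le_of_imgMass_le hUM hO (fun z x => z.1 = u ∧ 0 < v ∧ S z.2 x)
      (fun z => likely μ M Y (v - 1) z.2) τ fun z x hz => hlow _ _ hz.2.2 hz.2.1).trans ?_
    exact mul_le_mul_of_nonneg_left (pr_mono μ fun ω hω => hω.1) hτ0.le
  have b3 : pr μ B3 ≤ τ * P := by
    refine (pr_le_of_imgMass_le hUM hO (fun z x => z.1 = u ∧ S z.2 x)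
      (fun z => (G z.2)ᶜ) τ fun z x hz => hup _ _ hz.2).trans ?_
    exact mul_le_mul_of_nonneg_left (pr_mono μ fun ω hω => hω.1) hτ0.le
  have b4 : pr μ B4 ≤ τ / 2 * P := by
    refine (pr_le_of_joint_le μ (fun ω => (U ω, M ω)) Y (fun z => z.1 = u) (fun z => G z.2) t
      (2 ^ (v + e)) (by positivity) fun z => hcard _).trans ?_
    refine mul_le_mul_of_nonneg_right ?_ hu.le
    rw [ht, ← Real.rpow_add (by norm_num)]
    calc (2 : ℝ) ^ (-(v + D) + (v + e)) ≤ 2 ^ (-a + -a) :=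
          Real.rpow_le_rpow_of_exponent_le (by norm_num) (by linarith)
      _ = τ * τ := Real.rpow_add (by norm_num) _ _
      _ ≤ τ / 2 := by nlinarith
  have hsub : {ω | |(- Real.logb 2 (cpr μ {ω' | Y ω' = Y ω}
        ({ω' | U ω' = U ω} ∩ {ω' | M ω' = M ω}))) - v| > D + hs μ U u} ∩ {ω | U ω = u} ⊆
      {ω | U ω = u ∧ ¬ S (M ω) (X ω)} ∪ (B1 ∪ (B2 ∪ (B3 ∪ B4))) := by
    rintro ω ⟨hω, hUω⟩
    change U ω = u at hUω
    by_contra hnot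
    simp only [Set.mem_union, not_or] at hnot
    obtain ⟨n0, n1, n2, n3, n4⟩ := hnot
    have hSω : S (M ω) (X ω) := by
      by_contra h
      exact n0 ⟨hUω, h⟩
    have hb : τ * P * pr μ {ω' | M ω' = M ω} < pr μ ({ω' | U ω' = u} ∩ {ω' | M ω' = M ω}) := by
      by_contra h
      exact n1 ⟨hUω, not_lt.1 h⟩
    have hYG : Y ω ∈ G (M ω) := by
      by_contra h
      exact n3 ⟨⟨hUω, hSω⟩, Finset.mem_compl.2 h⟩
    have hJ : t * pr μ ({ω' | U ω' = u} ∩ {ω' | M ω' = M ω}) <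
        pr μ ({ω' | Y ω' = Y ω} ∩ ({ω' | U ω' = u} ∩ {ω' | M ω' = M ω})) := by
      by_contra h
      refine n4 ⟨hUω, hYG, ?_⟩
      have e1 : {ω' | (U ω', M ω') = (U ω, M ω) ∧ Y ω' = Y ω} =
          {ω' | Y ω' = Y ω} ∩ ({ω' | U ω' = u} ∩ {ω' | M ω' = M ω}) := by
        ext ω'
        simp only [Prod.mk.injEq, Set.mem_ofPred_eq, Set.mem_inter_iff, hUω]
        tauto
      have e2 : {ω' | (U ω', M ω') = (U ω, M ω)} = {ω' | U ω' = u} ∩ {ω' | M ω' = M ω} := by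
        ext ω'
        simp only [Prod.mk.injEq, Set.mem_ofPred_eq, Set.mem_inter_iff, hUω]
      rw [e1, e2]
      exact not_lt.1 h
    rw [Set.mem_ofPred_eq, hUω] at hω
    refine absurd hω (not_lt.2 ?_)
    set b := pr μ ({ω' | U ω' = u} ∩ {ω' | M ω' = M ω}) with hbdef
    set c := cpr μ {ω' | Y ω' = Y ω} ({ω' | U ω' = u} ∩ {ω' | M ω' = M ω}) with hc
    have hb0 : 0 < b := lt_of_le_of_lt (mul_nonneg (by positivity) (pr_nonneg _ _)) hb
    have hct : t < c := (lt_div_iff₀ hb0).2 hJ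
    have ht0 : 0 < t := by positivity
    have hupper : -(v + D) < Real.logb 2 c := by
      rw [Real.lt_logb_iff_rpow_lt (by norm_num) (ht0.trans hct)]
      exact hct
    rw [abs_le]
    refine ⟨?_, by linarith⟩
    rcases Nat.eq_zero_or_pos v with hv | hv
    · have : Real.logb 2 c ≤ 0 :=
        Real.logb_nonpos (by norm_num) (ht0.trans hct).le (cpr_le_one _ _ _)
      subst hv
      push_cast
      linarith
    · have hYl : Y ω ∉ likely μ M Y (v - 1) (M ω) := fun h => n2 ⟨⟨hUω, hv, hSω⟩, h⟩
      rw [notMem_likely] at hYl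
      have hm : 0 < pr μ {ω' | M ω' = M ω} :=
        hb0.trans_le (pr_mono μ Set.inter_subset_right)
      have hcle : c ≤ cpr μ {ω' | Y ω' = Y ω} {ω' | M ω' = M ω} / (τ * P) := by
        rw [hc, cpr, cpr, div_div]
        refine div_le_div₀ (pr_nonneg _ _) (pr_mono μ ?_) (by positivity) ?_
        · rintro ω' ⟨h1, -, h2⟩
          exact ⟨h1, h2⟩
        · rw [mul_comm]
          exact hb.le
      have hclt : c < 2 ^ (-((v : ℝ) - 1)) / (τ * P) :=
        hcle.trans_lt (div_lt_div_of_pos_right hYl (by positivity))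
      have hlog := Real.logb_lt_logb (b := 2) (by norm_num) (ht0.trans hct) hclt
      rw [Real.logb_div (by positivity) (by positivity), Real.logb_mul hτ0.ne' hu.ne', hτ,
        Real.logb_rpow (by norm_num) (by norm_num), Real.logb_rpow (by norm_num) (by norm_num)]
        at hlog
      have hhs' : hs μ U u = -Real.logb 2 P := rfl
      linarith
  rw [cpr, div_lt_iff₀ hu]
  calc _ ≤ _ := pr_mono μ hsub
    _ ≤ 0 + (τ * P + (τ * P + (τ * P + τ / 2 * P))) := by
      refine (pr_union_le μ _ _).trans (add_le_add hS.le ?_)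
      refine (pr_union_le μ _ _).trans (add_le_add b1 ?_)
      refine (pr_union_le μ _ _).trans (add_le_add b2 ?_)
      exact (pr_union_le μ _ _).trans (add_le_add b3 b4)
    _ < 4 * τ * P := by nlinarith [mul_pos hτ0 hu]

end Spectrum

theorem one_le_neg_logb {α : ℝ} (hα : 0 < α) (hα' : α < 1 / (8 * Real.log 2)) :
    1 ≤ -Real.logb 2 α := by
  have hl : 0.69 < Real.log 2 := lt_trans (by norm_num) Real.log_two_gt_d9
  have h : α ≤ (2 : ℝ) ^ (-1 : ℝ) := by
    rw [Real.rpow_neg_one]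
    refine hα'.le.trans ?_
    rw [one_div]
    exact inv_anti₀ (by norm_num) (by linarith)
  have := (Real.logb_le_iff_le_rpow (b := 2) (by norm_num) hα).2 h
  linarith

theorem rpow_mul_pow_le {α : ℝ} (hα : 0 < α) (q n : ℕ) :
    √α ^ (-(2 * n * √α)) * (1 + q * √α) ^ n ≤
      (2 : ℝ) ^ (n * (√α * (-Real.logb 2 α) + 2 * q * √α)) := by
  have hs : 0 < √α := Real.sqrt_pos.2 hα
  have h1 : √α ^ (-(2 * n * √α)) = (2 : ℝ) ^ (n * (√α * (-Real.logb 2 α))) := by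
    have : α = 2 ^ Real.logb 2 α := (Real.rpow_logb (by norm_num) (by norm_num) hα).symm
    rw [Real.sqrt_eq_rpow, ← Real.rpow_mul hα.le, ← Real.sqrt_eq_rpow]
    conv_lhs => enter [1]; rw [this]
    rw [← Real.rpow_mul (by norm_num)]
    congr 1
    ring
  have h2 : (1 + q * √α) ^ n ≤ (2 : ℝ) ^ (n * (2 * q * √α)) := by
    have hl : 0.69 < Real.log 2 := lt_trans (by norm_num) Real.log_two_gt_d9
    have hqs : 0 ≤ q * √α := by positivity
    rw [mul_comm (n : ℝ), Real.rpow_mul (by norm_num), Real.rpow_natCast]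
    refine pow_le_pow_left₀ (by positivity) ?_ n
    rw [Real.rpow_def_of_pos (by norm_num)]
    refine le_trans ?_ (Real.add_one_le_exp _)
    nlinarith
  rw [h1, mul_add, Real.rpow_add (by norm_num)]
  gcongr

theorem overflow_lt {q n ζ : ℕ} (hq : 2 ≤ q) (hn : 27 ≤ n) (hζ : 0 < ζ) {k : ℝ}
    (hk : 2 * ζ * n * Real.logb 2 q - 3 ≤ k) :
    2 * ((q : ℝ) ^ n * 2 ^ (-k)) < ((n : ℝ) / 8) ^ (-(((ζ : ℝ) - 1) / n)) := by
  have hq' : (2 : ℝ) ≤ q := by exact_mod_cast hq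
  have hn' : (27 : ℝ) ≤ n := by exact_mod_cast hn
  have hζ' : (1 : ℝ) ≤ ζ := by exact_mod_cast hζ
  have hl : 1 ≤ Real.logb 2 q := by
    rw [Real.le_logb_iff_rpow_le (by norm_num) (by linarith)]
    simpa using hq'
  have hqn : (q : ℝ) ^ n = 2 ^ (n * Real.logb 2 q) := by
    rw [mul_comm, Real.rpow_mul (by norm_num), Real.rpow_natCast,
      Real.rpow_logb (by norm_num) (by norm_num) (by linarith)]
  have hlow : (2 : ℝ) ^ (-((ζ : ℝ) - 1)) ≤ ((n : ℝ) / 8) ^ (-(((ζ : ℝ) - 1) / n)) := by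
    have h2 : (n : ℝ) / 8 ≤ 2 ^ (n : ℝ) := by
      have : (n : ℝ) < 2 ^ n := by exact_mod_cast Nat.lt_two_pow_self
      rw [Real.rpow_natCast]
      linarith
    calc (2 : ℝ) ^ (-((ζ : ℝ) - 1)) = ((2 : ℝ) ^ (n : ℝ)) ^ (-(((ζ : ℝ) - 1) / n)) := by
          rw [← Real.rpow_mul (by norm_num)]
          congr 1
          field_simp
      _ ≤ _ := Real.rpow_le_rpow_of_nonpos (by linarith) h2
          (neg_nonpos.2 (div_nonneg (by linarith) (by linarith)))
  refine lt_of_lt_of_le ?_ hlow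
  have : 2 * ((q : ℝ) ^ n * 2 ^ (-k)) = 2 ^ (1 + (n * Real.logb 2 q + -k)) := by
    rw [Real.rpow_add (by norm_num), Real.rpow_add (by norm_num), ← hqn, Real.rpow_one]
  rw [this]
  refine Real.rpow_lt_rpow_of_exponent_lt (by norm_num) ?_
  have h27 : 27 ≤ n * Real.logb 2 q := by nlinarith
  nlinarith [mul_nonneg (sub_nonneg.2 h27) (sub_nonneg.2 hζ')]

/-- Lemma `part2`. -/
theorem exists_stabilizing_partition_message_free (c𝒴 : ℕ) :
    ∃ C : ℝ, 0 < C ∧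
      ∀ (𝒳 𝒴 : Type) [Fintype 𝒳] [Fintype 𝒴], Fintype.card 𝒴 = c𝒴 →
      2 ≤ Fintype.card 𝒳 → 2 ≤ Fintype.card 𝒴 →
      ∀ (n : ℕ), 27 ≤ n →
      ∀ (Ω : Type) (μ : PMF Ω) (𝓜 : Type) [Fintype 𝓜] (M : Ω → 𝓜)
        (W : Channel 𝒳 𝒴) (X : Ω → Fin n → 𝒳) (Y : Ω → Fin n → 𝒴),
        Markov μ M X Y →
        IsOutput μ X Y W →
      ∀ α : ℝ, Real.logb 2 n / n < α → α < 1 / (8 * Real.log 2) →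
      ∀ ζ : ℕ, 0 < ζ →
      ∃ (𝒱 : Type) (_ : Fintype 𝒱) (f : (Fin n → 𝒳) × 𝓜 → 𝒱) (v₀ : 𝒱)
        (δ : ℝ) (r : 𝒱 → ℝ),
        ((Fintype.card 𝒱 : ℝ) ≤ 2 * ζ * n * Real.logb 2 (Fintype.card 𝒴)) ∧
        pr μ {ω | f (X ω, M ω) = v₀} < ((n : ℝ) / 8) ^ (-(((ζ : ℝ) - 1) / n)) ∧
        0 < δ ∧ δ ≤ C * Real.sqrt α * (- Real.logb 2 α) ∧
        (∀ v : 𝒱, 0 ≤ r v) ∧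
        ∀ (𝒰 : Type) [Fintype 𝒰], ∀ (U : Ω → 𝒰) (g : 𝒰 → 𝒱),
          pr μ {ω | f (X ω, M ω) = g (U ω)} = 1 →
          Markov μ (fun ω => (U ω, M ω)) X Y →
          ∀ u : 𝒰, 0 < pr μ {ω | U ω = u} →
            cpr μ {ω | f (X ω, M ω) = v₀} {ω | U ω = u} = 0 →
            cpr μ
              {ω | |(- Real.logb 2 (cpr μ {ω' | Y ω' = Y ω}
                      ({ω' | U ω' = U ω} ∩ {ω' | M ω' = M ω}))) - r (g u)| >
                n * δ + hs μ U u}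
              {ω | U ω = u} < 4 * 2 ^ (-(n : ℝ) * α) := by
  refine ⟨2 * c𝒴 + 3, by positivity, ?_⟩
  intro 𝒳 𝒴 _ _ hc _ h𝒴 n hn Ω μ 𝓜 _ M W X Y hM hO α hα hα' ζ hζ
  subst hc
  set q := Fintype.card 𝒴 with hq
  have hn' : (27 : ℝ) ≤ n := by exact_mod_cast hn
  have hq' : (2 : ℝ) ≤ q := by exact_mod_cast h𝒴
  have hζ' : (1 : ℝ) ≤ ζ := by exact_mod_cast hζ
  have hlogn : 1 ≤ Real.logb 2 n := by
    rw [Real.le_logb_iff_rpow_le (by norm_num) (by linarith)]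
    norm_num
    linarith
  have hlogq : 1 ≤ Real.logb 2 q := by
    rw [Real.le_logb_iff_rpow_le (by norm_num) (by linarith)]
    simpa using hq'
  have hα0 : 0 < α := lt_trans (div_pos (by linarith) (by linarith)) hα
  have hnα : 1 ≤ n * α := by
    rw [div_lt_iff₀ (by linarith)] at hα
    linarith
  have hlogα := one_le_neg_logb hα0 hα'
  have hs0 : 0 < √α := Real.sqrt_pos.2 hα0
  have hα1 : α ≤ 1 := by
    by_contra h
    have := Real.logb_nonneg (b := 2) (by norm_num) (not_le.1 h).le
    linarith
  have hs1 : √α ≤ 1 := Real.sqrt_le_one.2 hα1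
  have hαs : α ≤ √α := by nlinarith [Real.mul_self_sqrt hα0.le]
  set L := ⌊2 * ζ * n * Real.logb 2 q⌋₊ with hL
  have hbig : 54 ≤ 2 * ζ * n * Real.logb 2 q := by
    have h1 : 27 ≤ ζ * (n : ℝ) := by nlinarith
    nlinarith
  have hL54 : 54 ≤ L := Nat.le_floor (by exact_mod_cast hbig)
  have hLlow : 2 * ζ * n * Real.logb 2 q < L + 1 := Nat.lt_floor_add_one _
  set τ : ℝ := 2 ^ (-(n : ℝ) * α) with hτ
  have hτ2 : τ ≤ 1 / 2 := by
    calc τ ≤ (2 : ℝ) ^ (-1 : ℝ) :=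
          Real.rpow_le_rpow_of_exponent_le (by norm_num) (by linarith)
      _ = 1 / 2 := by rw [Real.rpow_neg_one]; norm_num
  have hcell : ∀ p : (Fin n → 𝒳) × 𝓜, ∃ v : Fin L,
      ((v : ℕ) ≠ L - 1 → τ ≤ imgMass W n p.1 (likely μ M Y (v : ℕ) p.2)) ∧
      ∀ k : ℕ, k < v → imgMass W n p.1 (likely μ M Y k p.2) < τ := by
    intro p
    have hex : ∃ k : ℕ, k = L - 1 ∨ τ ≤ imgMass W n p.1 (likely μ M Y k p.2) :=
      ⟨L - 1, Or.inl rfl⟩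
    have hle : Nat.find hex ≤ L - 1 := Nat.find_min' hex (Or.inl rfl)
    refine ⟨⟨Nat.find hex, by omega⟩, fun h => (Nat.find_spec hex).resolve_left h, ?_⟩
    intro k hk
    have := Nat.find_min hex hk
    push Not at this
    exact this.2
  choose f hf1 hf2 using hcell
  set D := (2 * (q : ℝ) + 3) * √α * (-Real.logb 2 α) with hDdef
  have hD : n * (√α * (-Real.logb 2 α) + 2 * q * √α) + 2 * (n * α) ≤ n * D := by
    have h1 : √α ≤ √α * (-Real.logb 2 α) := le_mul_of_one_le_right hs0.le hlogα
    have h2 : √α * (-Real.logb 2 α) + 2 * q * √α + 2 * α ≤ D := by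
      have h3 : q * √α ≤ q * (√α * (-Real.logb 2 α)) := by gcongr
      rw [hDdef]
      nlinarith
    nlinarith
  have he : 0 ≤ n * (√α * (-Real.logb 2 α) + 2 * q * √α) := by
    have : 0 ≤ √α * (-Real.logb 2 α) := mul_nonneg hs0.le (by linarith)
    positivity
  refine ⟨Fin L, inferInstance, f, ⟨L - 1, by omega⟩, D, fun v => (v : ℕ), ?_, ?_, ?_, le_rfl,
    fun v => Nat.cast_nonneg _, ?_⟩
  · rw [Fintype.card_fin]
    exact Nat.floor_le (by linarith)
  · have h1 := pr_le_of_likely_mass_le hM hO (fun m x => f (x, m) = ⟨L - 1, by omega⟩)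
      ((L - 2 : ℕ) : ℝ) fun m x h =>
        (hf2 (x, m) (L - 2) (by rw [h]; change L - 2 < L - 1; omega)).le.trans hτ2
    refine h1.trans_lt (overflow_lt h𝒴 hn hζ ?_)
    rw [Nat.cast_sub (by omega)]
    push_cast
    linarith
  · exact mul_pos (by positivity) (by linarith)
  · intro 𝒰 _ U g hg hUM u hu hv₀
    have hS : pr μ {ω | U ω = u ∧ ¬ f (X ω, M ω) = g u} = 0 := by
      refine le_antisymm ?_ (pr_nonneg _ _)
      calc _ ≤ pr μ {ω | f (X ω, M ω) = g (U ω)}ᶜ := by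
            refine pr_mono μ ?_
            rintro ω ⟨rfl, h⟩
            exact h
        _ = 0 := by rw [pr_compl, hg, sub_self]
    have hgu : ((g u : Fin L) : ℕ) ≠ L - 1 := by
      intro h
      have hg' : g u = ⟨L - 1, by omega⟩ := Fin.ext h
      rw [hg'] at hS
      rw [cpr, div_eq_zero_iff, or_iff_left hu.ne'] at hv₀
      have h3 : {ω | U ω = u} ⊆
          ({ω | f (X ω, M ω) = ⟨L - 1, by omega⟩} ∩ {ω | U ω = u}) ∪
            {ω | U ω = u ∧ ¬ f (X ω, M ω) = ⟨L - 1, by omega⟩} := by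
        intro ω hω
        by_cases h : f (X ω, M ω) = ⟨L - 1, by omega⟩
        · exact Or.inl ⟨h, hω⟩
        · exact Or.inr ⟨hω, h⟩
      have h4 := (pr_mono μ h3).trans (pr_union_le μ _ _)
      rw [hv₀, hS] at h4
      linarith
    have key := cpr_spectrum_deviation_lt hUM hO (fun m x => f (x, m) = g u) u hu hS
      (g u : ℕ) (n * α) (n * (√α * (-Real.logb 2 α) + 2 * q * √α)) (n * D) hnα hD (by linarith)
      (fun m => nbhd (likely μ M Y (g u : ℕ) m) (2 * n * √α)) ?_ ?_ ?_
    · rw [← neg_mul] at key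
      exact key
    · intro m
      refine (card_nbhd_le _ _ _ hs0 hs1).trans ?_
      rw [Real.rpow_add (by norm_num)]
      exact mul_le_mul (card_le_of_cpr μ Y _ _) (rpow_mul_pow_le hα0 _ _) (by positivity)
        (by positivity)
    · intro m x h
      rw [← neg_mul]
      refine imgMass_compl_nbhd_le W x _ α hα0 ?_
      have := hf1 (x, m) (by rw [h]; exact hgu)
      rwa [h] at this
    · intro m x h hpos
      rw [← neg_mul]
      have := hf2 (x, m) ((g u : ℕ) - 1) (by rw [h]; omega)
      rw [Nat.cast_sub hpos] at this
      push_cast at this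
      exact this.le

end Paper
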